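/- For every s₀ ∈ (0, π/2) and every n ∈ ℕ there is a constant C > 0 such that |K^{(n)}(x)| ≤ C·exp(−s₀|x|) for all x with |x| ≥ 1/2, where K^{(n)} is the n-th iterated derivative of the Whitham kernel K. -/

import Mathlib

open Real Filter MeasureTheory

/-- The Whitham symbol `m(ξ) = √(tanh ξ / ξ)`, with `m 0 = 1`. -/
noncomputable def whithamSymbol (ξ : ℝ) : ℝ :=
  if ξ = 0 then 1 else Real.sqrt (Real.tanh ξ / ξ)

/-- The Whitham kernel, defined for `x ≠ 0` as the improper integral
`K(x) = (1/π)·lim_{R→∞} ∫₀^R m(ξ) cos(xξ) dξ`, and `K 0 = 0`. -/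
noncomputable def whithamKernel (x : ℝ) : ℝ :=
  if x = 0 then 0 else
    limUnder atTop
      (fun R : ℝ => (1 / Real.pi) * ∫ ξ in (0:ℝ)..R, whithamSymbol ξ * Real.cos (x * ξ))

theorem Complex.sinh_eq_re_im (z : ℂ) :
    Complex.sinh z = (Real.sinh z.re * Real.cos z.im : ℝ) +
      (Real.cosh z.re * Real.sin z.im : ℝ) * Complex.I := by
  conv_lhs => rw [← Complex.re_add_im z, Complex.sinh_add, Complex.sinh_mul_I, Complex.cosh_mul_I]
  push_cast
  ring

theorem Complex.cosh_eq_re_im (z : ℂ) :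
    Complex.cosh z = (Real.cosh z.re * Real.cos z.im : ℝ) +
      (Real.sinh z.re * Real.sin z.im : ℝ) * Complex.I := by
  conv_lhs => rw [← Complex.re_add_im z, Complex.cosh_add, Complex.sinh_mul_I, Complex.cosh_mul_I]
  push_cast
  ring

theorem Complex.normSq_sinh (z : ℂ) :
    Complex.normSq (Complex.sinh z) = Real.cosh z.re ^ 2 - Real.cos z.im ^ 2 := by
  rw [Complex.sinh_eq_re_im, Complex.normSq_add_mul_I, mul_pow, mul_pow, Real.sin_sq,
    Real.sinh_sq]
  ring

theorem Complex.normSq_cosh (z : ℂ) :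
    Complex.normSq (Complex.cosh z) = Real.sinh z.re ^ 2 + Real.cos z.im ^ 2 := by
  rw [Complex.cosh_eq_re_im, Complex.normSq_add_mul_I, mul_pow, mul_pow, Real.sin_sq,
    Real.cosh_sq]
  ring

theorem Complex.cosh_ne_zero_of_re_pos {z : ℂ} (hz : 0 < z.re) : Complex.cosh z ≠ 0 := by
  rw [← Complex.normSq_pos, Complex.normSq_cosh]
  have := Real.sinh_pos_iff.2 hz
  positivity

theorem Complex.tanh_re_pos {z : ℂ} (hz : 0 < z.re) : 0 < (Complex.sinh z / Complex.cosh z).re := by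
  have h1 := Complex.normSq_pos.2 (Complex.cosh_ne_zero_of_re_pos hz)
  have h2 := Real.sinh_pos_iff.2 hz
  have h3 := Real.cosh_pos z.re
  rw [Complex.div_re, ← add_div]
  refine div_pos ?_ h1
  rw [Complex.sinh_eq_re_im, Complex.cosh_eq_re_im]
  simp only [Complex.add_re, Complex.add_im, Complex.re_ofReal_mul, Complex.im_ofReal_mul,
    Complex.ofReal_re, Complex.ofReal_im, Complex.I_re, Complex.I_im]
  have := Real.sin_sq_add_cos_sq z.im
  have h4 := mul_pos h2 h3
  nlinarith

theorem Complex.div_mem_slitPlane {a b : ℂ} (ha : 0 < a.re) (hb : 0 < b.re) :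
    a / b ∈ Complex.slitPlane := by
  rw [Complex.mem_slitPlane_iff]
  by_contra! h
  have hb0 : b ≠ 0 := by rintro rfl; simp at hb
  have h1 : a = ((a / b).re : ℂ) * b := by
    have : ((a / b).re : ℂ) = a / b := Complex.ext (by simp) (by simp [h.2])
    rw [this, div_mul_cancel₀ _ hb0]
  have h2 : a.re = (a / b).re * b.re := by
    conv_lhs => rw [h1]
    simp
  nlinarith [h.1]

/-- The extension of `tanh z / z` to the complex plane, with value `1` at `0`. -/
noncomputable def tanhc (z : ℂ) : ℂ := dslope Complex.sinh 0 z / Complex.cosh z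

theorem tanhc_zero : tanhc 0 = 1 := by
  simp [tanhc]

theorem tanhc_of_ne_zero {z : ℂ} (hz : z ≠ 0) :
    tanhc z = Complex.sinh z / Complex.cosh z / z := by
  rw [tanhc, dslope_of_ne _ hz, slope_def_field]
  simp [div_right_comm]

theorem differentiableAt_tanhc {z : ℂ} (hz : Complex.cosh z ≠ 0) :
    DifferentiableAt ℂ tanhc z := by
  have : DifferentiableOn ℂ (dslope Complex.sinh 0) Set.univ :=
    (Complex.differentiableOn_dslope Filter.univ_mem).2 Complex.differentiable_sinh.differentiableOn
  exact (this.differentiableAt Filter.univ_mem).div Complex.differentiable_cosh.differentiableAt hz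

theorem tanhc_mem_slitPlane_of_re_pos {z : ℂ} (hz : 0 < z.re) :
    tanhc z ∈ Complex.slitPlane := by
  have hz0 : z ≠ 0 := by rintro rfl; simp at hz
  rw [tanhc_of_ne_zero hz0]
  exact Complex.div_mem_slitPlane (Complex.tanh_re_pos hz) hz

theorem tanhc_mul_I {s : ℝ} (hs : s ≠ 0) :
    tanhc (s * Complex.I) = (Real.sin s / Real.cos s / s : ℝ) := by
  rw [tanhc_of_ne_zero (by simpa using hs), Complex.sinh_mul_I, Complex.cosh_mul_I]
  have : (s : ℂ) ≠ 0 := by exact_mod_cast hs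
  push_cast
  field_simp

theorem tanhc_mul_I_pos {s : ℝ} (hs : 0 ≤ s) (hs' : s < Real.pi / 2) :
    ∃ r : ℝ, 0 < r ∧ tanhc (s * Complex.I) = r := by
  rcases hs.eq_or_lt with rfl | h
  · exact ⟨1, one_pos, by simp [tanhc_zero]⟩
  · refine ⟨_, ?_, tanhc_mul_I h.ne'⟩
    have := Real.sin_pos_of_pos_of_lt_pi h (by linarith [Real.pi_pos])
    have := Real.cos_pos_of_mem_Ioo ⟨by linarith, hs'⟩
    positivity

/-- The analytic continuation of the Whitham symbol. -/
noncomputable def whithamSymbolC (z : ℂ) : ℂ := tanhc z ^ (((2 : ℕ) : ℂ)⁻¹)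

theorem whithamSymbolC_ofReal_of_nonneg {z : ℂ} {r : ℝ} (hr : 0 ≤ r) (h : tanhc z = r) :
    whithamSymbolC z = (Real.sqrt r : ℝ) := by
  rw [whithamSymbolC, h, Real.sqrt_eq_rpow, Complex.ofReal_cpow hr]
  norm_num

theorem whithamSymbolC_ofReal (ξ : ℝ) : whithamSymbolC ξ = whithamSymbol ξ := by
  by_cases h : ξ = 0
  · subst h
    rw [whithamSymbolC_ofReal_of_nonneg zero_le_one (by simpa using tanhc_zero)]
    simp [whithamSymbol]
  · rw [whithamSymbolC_ofReal_of_nonneg (r := Real.tanh ξ / ξ), whithamSymbol, if_neg h]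
    · rw [Real.tanh_eq_sinh_div_cosh]
      rcases lt_or_gt_of_ne h with h | h
      · exact div_nonneg_of_nonpos
          (div_nonpos_of_nonpos_of_nonneg (Real.sinh_neg_iff.2 h).le (Real.cosh_pos _).le) h.le
      · exact div_nonneg (div_nonneg (Real.sinh_pos_iff.2 h).le (Real.cosh_pos _).le) h.le
    · rw [tanhc_of_ne_zero (by exact_mod_cast h), Real.tanh_eq_sinh_div_cosh]
      push_cast
      rfl

theorem differentiableAt_whithamSymbolC {z : ℂ}
    (hz : 0 < z.re ∨ z.re = 0 ∧ 0 ≤ z.im ∧ z.im < Real.pi / 2) :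
    DifferentiableAt ℂ whithamSymbolC z := by
  rcases hz with hz | ⟨h0, h1, h2⟩
  · exact (differentiableAt_tanhc (Complex.cosh_ne_zero_of_re_pos hz)).cpow_const
      (tanhc_mem_slitPlane_of_re_pos hz)
  · have hz : z = z.im * Complex.I := Complex.ext (by simp [h0]) (by simp)
    refine (differentiableAt_tanhc ?_).cpow_const ?_
    · rw [← Complex.normSq_pos, Complex.normSq_cosh]
      have := Real.cos_pos_of_mem_Ioo (x := z.im) ⟨by linarith, h2⟩
      positivity
    · obtain ⟨r, hr, h⟩ := tanhc_mul_I_pos h1 h2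
      rw [hz, h]
      exact Complex.ofReal_mem_slitPlane.2 hr

theorem norm_whithamSymbolC_le {z : ℂ} (hz : 1 ≤ z.re) :
    ‖whithamSymbolC z‖ ≤ Real.sqrt (2 / z.re) := by
  have hz' : 0 < z.re := by linarith
  have hz0 : z ≠ 0 := by rintro rfl; simp at hz'
  refine Real.le_sqrt_of_sq_le ?_
  rw [← norm_pow, whithamSymbolC, Complex.cpow_nat_inv_pow _ two_ne_zero, tanhc_of_ne_zero hz0,
    norm_div]
  refine div_le_div₀ zero_le_two ?_ hz' (Complex.re_le_norm z)
  have hs := Real.sinh_pos_iff.2 hz'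
  have hc : Real.cosh z.re ≤ 2 * Real.sinh z.re := by
    rw [Real.cosh_eq, Real.sinh_eq]
    have h1 : 2 ≤ Real.exp z.re := by linarith [Real.add_one_le_exp z.re]
    have h2 : Real.exp z.re * Real.exp (-z.re) = 1 := by rw [← Real.exp_add]; simp
    nlinarith [Real.exp_pos (-z.re)]
  rw [norm_div, div_le_iff₀ (norm_pos_iff.2 (Complex.cosh_ne_zero_of_re_pos hz'))]
  refine abs_le_of_sq_le_sq' ?_ (by positivity) |>.2
  rw [mul_pow, ← Complex.normSq_eq_norm_sq, ← Complex.normSq_eq_norm_sq, Complex.normSq_sinh,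
    Complex.normSq_cosh]
  nlinarith [Real.cosh_pos z.re, sq_nonneg (Real.cos z.im)]

theorem norm_fourierLaplace_integrand_le {c : ℝ} {g z : ℂ} (hc : c ≤ z.im) (k : ℕ) {x : ℝ}
    (hx : 1 / 4 ≤ x) :
    ‖g * (Complex.I * z) ^ k * Complex.exp (Complex.I * x * z)‖ ≤
      Real.exp (-c * (x - 1 / 4)) * (‖g‖ * ‖z‖ ^ k * Real.exp (-z.im / 4)) := by
  rw [norm_mul, norm_mul, norm_pow, norm_mul, Complex.norm_I, one_mul, Complex.norm_exp]
  have h1 : (Complex.I * x * z).re = -x * z.im := by simp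
  have h2 : Real.exp (-x * z.im) ≤ Real.exp (-c * (x - 1 / 4)) * Real.exp (-z.im / 4) := by
    rw [← Real.exp_add, Real.exp_le_exp]
    nlinarith
  rw [h1]
  calc _ ≤ ‖g‖ * ‖z‖ ^ k * (Real.exp (-c * (x - 1 / 4)) * Real.exp (-z.im / 4)) := by gcongr
    _ = _ := by ring

section FourierLaplace

variable {μ : Measure ℝ} {g z : ℝ → ℂ} {c : ℝ}

theorem aestronglyMeasurable_fourierLaplace_integrand
    (hg : AEStronglyMeasurable g μ) (hz : AEStronglyMeasurable z μ) (k : ℕ) (x : ℝ) :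
    AEStronglyMeasurable
      (fun t => g t * (Complex.I * z t) ^ k * Complex.exp (Complex.I * x * z t)) μ :=
  (hg.mul ((hz.const_mul _).pow k)).mul
    (Complex.continuous_exp.comp_aestronglyMeasurable (hz.const_mul _))

theorem integrable_fourierLaplace_integrand
    (hg : AEStronglyMeasurable g μ) (hz : AEStronglyMeasurable z μ)
    (hc : ∀ᵐ t ∂μ, c ≤ (z t).im) {k : ℕ}
    (hint : Integrable (fun t => ‖g t‖ * ‖z t‖ ^ k * Real.exp (-(z t).im / 4)) μ)
    {x : ℝ} (hx : 1 / 4 ≤ x) :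
    Integrable (fun t => g t * (Complex.I * z t) ^ k * Complex.exp (Complex.I * x * z t)) μ :=
  (hint.const_mul (Real.exp (-c * (x - 1 / 4)))).mono'
    (aestronglyMeasurable_fourierLaplace_integrand hg hz k x)
    (hc.mono fun _ ht => norm_fourierLaplace_integrand_le ht k hx)

theorem norm_integral_fourierLaplace_le
    (hc : ∀ᵐ t ∂μ, c ≤ (z t).im) {k : ℕ}
    (hint : Integrable (fun t => ‖g t‖ * ‖z t‖ ^ k * Real.exp (-(z t).im / 4)) μ)
    {x : ℝ} (hx : 1 / 4 ≤ x) :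
    ‖∫ t, g t * (Complex.I * z t) ^ k * Complex.exp (Complex.I * x * z t) ∂μ‖ ≤
      Real.exp (-c * (x - 1 / 4)) *
        ∫ t, ‖g t‖ * ‖z t‖ ^ k * Real.exp (-(z t).im / 4) ∂μ := by
  rw [← integral_const_mul]
  exact norm_integral_le_of_norm_le (hint.const_mul _)
    (hc.mono fun _ ht => norm_fourierLaplace_integrand_le ht k hx)

theorem hasDerivAt_integral_fourierLaplace
    (hg : AEStronglyMeasurable g μ) (hz : AEStronglyMeasurable z μ)
    (hc0 : 0 ≤ c) (hc : ∀ᵐ t ∂μ, c ≤ (z t).im)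
    (hint : ∀ k : ℕ, Integrable (fun t => ‖g t‖ * ‖z t‖ ^ k * Real.exp (-(z t).im / 4)) μ)
    (k : ℕ) {x : ℝ} (hx : 1 / 4 < x) :
    HasDerivAt
      (fun x : ℝ => ∫ t, g t * (Complex.I * z t) ^ k * Complex.exp (Complex.I * x * z t) ∂μ)
      (∫ t, g t * (Complex.I * z t) ^ (k + 1) * Complex.exp (Complex.I * x * z t) ∂μ) x := by
  refine (hasDerivAt_integral_of_dominated_loc_of_deriv_le (s := Set.Ioi (1 / 4 : ℝ))
    (F' := fun (x : ℝ) t =>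
      g t * (Complex.I * z t) ^ (k + 1) * Complex.exp (Complex.I * x * z t))
    (Ioi_mem_nhds hx)
    (Eventually.of_forall fun x => aestronglyMeasurable_fourierLaplace_integrand hg hz k x)
    (integrable_fourierLaplace_integrand hg hz hc (hint k) hx.le)
    (aestronglyMeasurable_fourierLaplace_integrand hg hz (k + 1) x)
    (hc.mono fun t ht y hy => ?_) (hint (k + 1))
    (Eventually.of_forall fun t y _ => ?_)).2
  · refine (norm_fourierLaplace_integrand_le ht (k + 1) (Set.mem_Ioi.1 hy).le).trans ?_
    refine mul_le_of_le_one_left (by positivity) (Real.exp_le_one_iff.2 ?_)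
    nlinarith [Set.mem_Ioi.1 hy]
  · have h : HasDerivAt (fun y : ℝ => Complex.I * y * z t) (Complex.I * z t) y := by
      simpa using ((Complex.ofRealCLM.hasDerivAt (x := y)).const_mul Complex.I).mul_const (z t)
    refine (h.cexp.const_mul (g t * (Complex.I * z t) ^ k)).congr_deriv ?_
    ring

end FourierLaplace

/-- The analytic continuation of `whithamSymbol ξ * exp (i x ξ)`. -/
noncomputable def whithamIntegrand (x : ℝ) (z : ℂ) : ℂ :=
  whithamSymbolC z * Complex.exp (Complex.I * x * z)

theorem differentiableAt_whithamIntegrand (x : ℝ) {z : ℂ}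
    (hz : 0 < z.re ∨ z.re = 0 ∧ 0 ≤ z.im ∧ z.im < Real.pi / 2) :
    DifferentiableAt ℂ (whithamIntegrand x) z :=
  (differentiableAt_whithamSymbolC hz).mul (by fun_prop)

theorem norm_whithamIntegrand_le (x : ℝ) {z : ℂ} (hz : 1 ≤ z.re) :
    ‖whithamIntegrand x z‖ ≤ Real.sqrt (2 / z.re) * Real.exp (-x * z.im) := by
  rw [whithamIntegrand, norm_mul, Complex.norm_exp]
  have h1 : (Complex.I * x * z).re = -x * z.im := by simp
  rw [h1]
  gcongr
  exact norm_whithamSymbolC_le hz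

theorem whithamIntegrand_ofReal_re (x ξ : ℝ) :
    (whithamIntegrand x ξ).re = whithamSymbol ξ * Real.cos (x * ξ) := by
  rw [whithamIntegrand, whithamSymbolC_ofReal, Complex.re_ofReal_mul]
  have : Complex.I * x * ξ = ((x * ξ : ℝ) : ℂ) * Complex.I := by push_cast; ring
  rw [this, Complex.exp_ofReal_mul_I_re]

theorem whithamIntegrand_mul_I_im (x : ℝ) {y : ℝ} (hy : 0 ≤ y) (hy' : y < Real.pi / 2) :
    (whithamIntegrand x (y * Complex.I)).im = 0 := by
  obtain ⟨r, hr, h⟩ := tanhc_mul_I_pos hy hy'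
  have : Complex.I * x * (y * Complex.I) = ((-(x * y) : ℝ) : ℂ) := by
    push_cast
    linear_combination (x * y : ℂ) * Complex.I_sq
  rw [whithamIntegrand, whithamSymbolC_ofReal_of_nonneg hr.le h, this, ← Complex.ofReal_exp,
    ← Complex.ofReal_mul, Complex.ofReal_im]

theorem intervalIntegrable_whithamIntegrand (x : ℝ) {γ : ℝ → ℂ} (hγ : Continuous γ) {a b : ℝ}
    (h : ∀ t ∈ Set.uIcc a b,
      0 < (γ t).re ∨ (γ t).re = 0 ∧ 0 ≤ (γ t).im ∧ (γ t).im < Real.pi / 2) :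
    IntervalIntegrable (fun t => whithamIntegrand x (γ t)) volume a b := by
  refine ContinuousOn.intervalIntegrable fun t ht => ContinuousAt.continuousWithinAt ?_
  exact ContinuousAt.comp (differentiableAt_whithamIntegrand x (h t ht)).continuousAt
    hγ.continuousAt

theorem integral_whithamIntegrand_eq (x : ℝ) {s R : ℝ} (hs : 0 < s) (hs' : s < Real.pi / 2)
    (hR : 1 ≤ R) :
    ∫ t in (0 : ℝ)..R, whithamIntegrand x t =
      (∫ t in (0 : ℝ)..1, whithamIntegrand x (t + s * Complex.I)) +
      Complex.I * (∫ y in (0 : ℝ)..s, whithamIntegrand x (y * Complex.I)) +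
      Complex.I * (∫ y in s..R, whithamIntegrand x (1 + y * Complex.I)) +
      ((∫ t in (1 : ℝ)..R, whithamIntegrand x (t + R * Complex.I)) -
        Complex.I * ∫ y in (0 : ℝ)..R, whithamIntegrand x (R + y * Complex.I)) := by
  have h1 := Complex.integral_boundary_rect_eq_zero_of_differentiableOn (whithamIntegrand x) 0
    (1 + s * Complex.I) fun z hz => by
      refine (differentiableAt_whithamIntegrand x ?_).differentiableWithinAt
      rw [Complex.mem_reProdIm] at hz
      simp only [Complex.add_re, Complex.one_re, Complex.zero_re, Complex.zero_im,
        Complex.add_im, Complex.one_im, Complex.re_ofReal_mul, Complex.im_ofReal_mul,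
        Complex.I_re, Complex.I_im, mul_zero, mul_one, zero_add, add_zero,
        Set.uIcc_of_le zero_le_one, Set.uIcc_of_le hs.le, Set.mem_Icc] at hz
      rcases hz.1.1.eq_or_lt with h | h
      · exact Or.inr ⟨h.symm, hz.2.1, by linarith⟩
      · exact Or.inl h
  have h2 := Complex.integral_boundary_rect_eq_zero_of_differentiableOn (whithamIntegrand x) 1
    (R + R * Complex.I) fun z hz => by
      refine (differentiableAt_whithamIntegrand x (Or.inl ?_)).differentiableWithinAt
      rw [Complex.mem_reProdIm] at hz
      simp only [Complex.add_re, Complex.one_re, Complex.ofReal_re, Complex.re_ofReal_mul,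
        Complex.I_re, mul_zero, add_zero, Set.uIcc_of_le hR, Set.mem_Icc] at hz
      linarith [hz.1.1]
  simp only [Complex.add_re, Complex.one_re, Complex.zero_re, Complex.zero_im,
    Complex.add_im, Complex.one_im, Complex.re_ofReal_mul, Complex.im_ofReal_mul,
    Complex.ofReal_re, Complex.ofReal_im, Complex.ofReal_zero, Complex.ofReal_one, zero_mul,
    Complex.I_re, Complex.I_im, mul_zero, mul_one, zero_add, add_zero, smul_eq_mul] at h1 h2
  have h3 : (∫ t in (0 : ℝ)..1, whithamIntegrand x t) + ∫ t in (1 : ℝ)..R, whithamIntegrand x t =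
      ∫ t in (0 : ℝ)..R, whithamIntegrand x t := by
    refine intervalIntegral.integral_add_adjacent_intervals
      (intervalIntegrable_whithamIntegrand x Complex.continuous_ofReal fun t ht => ?_)
      (intervalIntegrable_whithamIntegrand x Complex.continuous_ofReal fun t ht => ?_)
    · rw [Set.uIcc_of_le zero_le_one] at ht
      rcases ht.1.eq_or_lt with h | h
      · exact Or.inr ⟨h.symm, by simp, by simp [Real.pi_pos]⟩
      · exact Or.inl h
    · rw [Set.uIcc_of_le hR] at ht
      exact Or.inl (by simpa using by linarith [ht.1])
  have hv : ∀ a b : ℝ, IntervalIntegrable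
      (fun y : ℝ => whithamIntegrand x (1 + y * Complex.I)) volume a b := fun a b =>
    intervalIntegrable_whithamIntegrand x (γ := fun y : ℝ => 1 + y * Complex.I) (by fun_prop)
      fun t _ => Or.inl (by simp)
  have h4 := intervalIntegral.integral_add_adjacent_intervals (hv 0 s) (hv s R)
  rw [← h3]
  linear_combination h1 + h2 - Complex.I * h4

theorem tendsto_integral_top_edge {x : ℝ} (hx : 0 < x) :
    Tendsto (fun R : ℝ => ∫ t in (1 : ℝ)..R, whithamIntegrand x (t + R * Complex.I)) atTop
      (nhds 0) := by
  have hlim : Tendsto (fun R : ℝ => Real.sqrt 2 * (R ^ (1 : ℝ) * Real.exp (-x * R))) atTop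
      (nhds 0) := by
    simpa using (tendsto_rpow_mul_exp_neg_mul_atTop_nhds_zero 1 x hx).const_mul (Real.sqrt 2)
  refine squeeze_zero_norm' ?_ hlim
  filter_upwards [eventually_ge_atTop 1] with R hR
  have h := intervalIntegral.norm_integral_le_of_norm_le_const (a := 1) (b := R)
    (f := fun t : ℝ => whithamIntegrand x (t + R * Complex.I))
    (C := Real.sqrt 2 * Real.exp (-x * R)) fun t ht => by
      rw [Set.uIoc_of_le hR] at ht
      refine (norm_whithamIntegrand_le x (by simpa using ht.1.le)).trans ?_
      simp only [Complex.add_re, Complex.add_im, Complex.ofReal_re, Complex.ofReal_im,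
        Complex.re_ofReal_mul, Complex.im_ofReal_mul, Complex.I_re, Complex.I_im, mul_zero,
        mul_one, zero_add, add_zero]
      gcongr
      exact div_le_self zero_le_two ht.1.le
  refine h.trans ?_
  rw [abs_of_nonneg (by linarith), Real.rpow_one]
  have : 0 < Real.sqrt 2 * Real.exp (-x * R) := by positivity
  nlinarith

theorem tendsto_integral_right_edge {x : ℝ} (hx : 0 < x) :
    Tendsto (fun R : ℝ => ∫ y in (0 : ℝ)..R, whithamIntegrand x (R + y * Complex.I)) atTop
      (nhds 0) := by
  have hlim : Tendsto (fun R : ℝ => Real.sqrt (2 / R) * (1 / x)) atTop (nhds 0) := by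
    have h := (Real.continuous_sqrt.tendsto 0).comp
      (tendsto_const_nhds (x := (2 : ℝ)).div_atTop tendsto_id)
    simpa using h.mul_const (1 / x)
  refine squeeze_zero_norm' ?_ hlim
  filter_upwards [eventually_ge_atTop 1] with R hR
  have h := intervalIntegral.norm_integral_le_of_norm_le (μ := volume) (a := 0) (b := R)
    (f := fun y : ℝ => whithamIntegrand x (R + y * Complex.I))
    (g := fun y : ℝ => Real.sqrt (2 / R) * Real.exp (-x * y)) (by linarith)
    (Eventually.of_forall fun y _ => by
      simpa using norm_whithamIntegrand_le x (z := R + y * Complex.I) (by simpa using hR))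
    (Continuous.intervalIntegrable (by fun_prop) _ _)
  refine h.trans ?_
  rw [intervalIntegral.integral_const_mul]
  gcongr
  rw [intervalIntegral.integral_comp_mul_left _ (neg_ne_zero.2 hx.ne'), integral_exp, smul_eq_mul,
    mul_zero, Real.exp_zero, inv_neg, ← one_div]
  have : 0 < 1 / x * Real.exp (-x * R) := by positivity
  linarith

theorem continuous_whithamSymbolC_vertical :
    Continuous fun y : ℝ => whithamSymbolC (1 + y * Complex.I) :=
  continuous_iff_continuousAt.2 fun y => ContinuousAt.comp (f := fun y : ℝ => 1 + y * Complex.I)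
    (differentiableAt_whithamSymbolC (Or.inl (by simp))).continuousAt
    (Continuous.continuousAt (by fun_prop))

theorem continuousOn_whithamSymbolC_horizontal {s : ℝ} (hs : 0 < s) (hs' : s < Real.pi / 2) :
    ContinuousOn (fun t : ℝ => whithamSymbolC (t + s * Complex.I)) (Set.Icc 0 1) := by
  refine fun t ht => ContinuousAt.continuousWithinAt ?_
  refine ContinuousAt.comp (f := fun t : ℝ => (t + s * Complex.I : ℂ))
    (differentiableAt_whithamSymbolC ?_).continuousAt (Continuous.continuousAt (by fun_prop))
  rcases ht.1.eq_or_lt with h | h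
  · exact Or.inr ⟨by simp [← h], by simpa using hs.le, by simpa using hs'⟩
  · exact Or.inl (by simpa using h)

theorem integrable_whitham_horizontal {s : ℝ} (hs : 0 < s) (hs' : s < Real.pi / 2) (k : ℕ) :
    Integrable (fun t : ℝ => ‖whithamSymbolC (t + s * Complex.I)‖ *
      ‖(t + s * Complex.I : ℂ)‖ ^ k * Real.exp (-(t + s * Complex.I : ℂ).im / 4))
      (volume.restrict (Set.Ioc 0 1)) := by
  refine IntegrableOn.mono_set (t := Set.Icc 0 1)
    (ContinuousOn.integrableOn_compact isCompact_Icc ?_) Set.Ioc_subset_Icc_self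
  refine ((continuousOn_whithamSymbolC_horizontal hs hs').norm.mul ?_).mul ?_ <;>
  exact Continuous.continuousOn (by fun_prop)

theorem integrable_whitham_vertical (s : ℝ) (k : ℕ) :
    Integrable (fun y : ℝ => ‖Complex.I * whithamSymbolC (1 + y * Complex.I)‖ *
      ‖(1 + y * Complex.I : ℂ)‖ ^ k * Real.exp (-(1 + y * Complex.I : ℂ).im / 4))
      (volume.restrict (Set.Ioi s)) := by
  have hcont := continuous_whithamSymbolC_vertical
  refine integrable_of_isBigO_exp_neg (b := 1 / 8) (by norm_num)
    (Continuous.continuousOn (by fun_prop)) ?_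
  refine Asymptotics.IsBigO.of_bound
    (Real.sqrt 2 * (k.factorial * 8 ^ k * Real.exp (1 / 8))) ?_
  filter_upwards [eventually_ge_atTop 0] with y hy
  have h1 : ‖whithamSymbolC (1 + y * Complex.I)‖ ≤ Real.sqrt 2 := by
    simpa using norm_whithamSymbolC_le (z := 1 + y * Complex.I) (by simp)
  have h2 : ‖(1 + y * Complex.I : ℂ)‖ ≤ 1 + y := by
    refine (norm_add_le _ _).trans ?_
    simp [abs_of_nonneg hy]
  have h3 : (1 + y) ^ k ≤ k.factorial * 8 ^ k * Real.exp (1 / 8 + y / 8) := by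
    have := Real.pow_div_factorial_le_exp (x := (1 + y) / 8) (by positivity) k
    rw [div_pow, div_div, div_le_iff₀ (by positivity)] at this
    rw [← add_div]
    linarith
  have him : (1 + y * Complex.I : ℂ).im = y := by simp
  rw [him, Real.norm_of_nonneg (by positivity), Real.norm_of_nonneg (by positivity), norm_mul,
    Complex.norm_I, one_mul]
  have h4 : Real.exp (1 / 8 + y / 8) * Real.exp (-y / 4) =
      Real.exp (1 / 8) * Real.exp (-(1 / 8) * y) := by
    rw [← Real.exp_add, ← Real.exp_add]
    congr 1
    ring
  calc _ ≤ Real.sqrt 2 * (k.factorial * 8 ^ k * Real.exp (1 / 8 + y / 8)) * Real.exp (-y / 4) := by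
        gcongr
        exact (pow_le_pow_left₀ (norm_nonneg _) h2 k).trans h3
    _ = Real.sqrt 2 * (k.factorial * 8 ^ k) * (Real.exp (1 / 8 + y / 8) * Real.exp (-y / 4)) := by
        ring
    _ = _ := by rw [h4]; ring

/-- The `n`-th derivative of the contour representation of `π * whithamKernel`, along the segment
from `i s` to `1 + i s` followed by the vertical ray from `1 + i s`. -/
noncomputable def whithamContour (s : ℝ) (n : ℕ) (x : ℝ) : ℂ :=
  (∫ t in Set.Ioc (0 : ℝ) 1, whithamSymbolC (t + s * Complex.I) *
    (Complex.I * (t + s * Complex.I)) ^ n * Complex.exp (Complex.I * x * (t + s * Complex.I))) +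
  ∫ y in Set.Ioi s, Complex.I * whithamSymbolC (1 + y * Complex.I) *
    (Complex.I * (1 + y * Complex.I)) ^ n * Complex.exp (Complex.I * x * (1 + y * Complex.I))

section Contour

variable {s : ℝ}

theorem ae_le_im_horizontal :
    ∀ᵐ t : ℝ ∂volume.restrict (Set.Ioc 0 1), s ≤ (t + s * Complex.I : ℂ).im :=
  Eventually.of_forall fun t => by simp

theorem ae_le_im_vertical :
    ∀ᵐ y : ℝ ∂volume.restrict (Set.Ioi s), s ≤ (1 + y * Complex.I : ℂ).im :=
  (ae_restrict_iff' measurableSet_Ioi).2 <| Eventually.of_forall fun y hy => by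
    simpa using (Set.mem_Ioi.1 hy).le

theorem aestronglyMeasurable_whithamSymbolC_horizontal (hs : 0 < s) (hs' : s < Real.pi / 2) :
    AEStronglyMeasurable (fun t : ℝ => whithamSymbolC (t + s * Complex.I))
      (volume.restrict (Set.Ioc 0 1)) :=
  ((continuousOn_whithamSymbolC_horizontal hs hs').mono
    Set.Ioc_subset_Icc_self).aestronglyMeasurable measurableSet_Ioc

theorem aestronglyMeasurable_whithamSymbolC_vertical :
    AEStronglyMeasurable (fun y : ℝ => Complex.I * whithamSymbolC (1 + y * Complex.I))
      (volume.restrict (Set.Ioi s)) :=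
  (continuous_whithamSymbolC_vertical.const_mul Complex.I).aestronglyMeasurable

theorem hasDerivAt_whithamContour (hs : 0 < s) (hs' : s < Real.pi / 2) (n : ℕ) {x : ℝ}
    (hx : 1 / 4 < x) : HasDerivAt (whithamContour s n) (whithamContour s (n + 1) x) x :=
  (hasDerivAt_integral_fourierLaplace (aestronglyMeasurable_whithamSymbolC_horizontal hs hs')
    (Continuous.aestronglyMeasurable (by fun_prop)) hs.le ae_le_im_horizontal
    (integrable_whitham_horizontal hs hs') n hx).add
  (hasDerivAt_integral_fourierLaplace aestronglyMeasurable_whithamSymbolC_vertical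
    (Continuous.aestronglyMeasurable (by fun_prop)) hs.le ae_le_im_vertical
    (integrable_whitham_vertical s) n hx)

theorem norm_whithamContour_le (hs : 0 < s) (hs' : s < Real.pi / 2) (n : ℕ) :
    ∃ C : ℝ, 0 ≤ C ∧ ∀ x : ℝ, 1 / 4 ≤ x → ‖whithamContour s n x‖ ≤ C * Real.exp (-s * x) := by
  set A := ∫ t in Set.Ioc (0 : ℝ) 1, ‖whithamSymbolC (t + s * Complex.I)‖ *
      ‖(t + s * Complex.I : ℂ)‖ ^ n * Real.exp (-(t + s * Complex.I : ℂ).im / 4) with hA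
  set B := ∫ y in Set.Ioi s, ‖Complex.I * whithamSymbolC (1 + y * Complex.I)‖ *
      ‖(1 + y * Complex.I : ℂ)‖ ^ n * Real.exp (-(1 + y * Complex.I : ℂ).im / 4) with hB
  have hA0 : 0 ≤ A := integral_nonneg fun t => by positivity
  have hB0 : 0 ≤ B := integral_nonneg fun t => by positivity
  refine ⟨Real.exp (s / 4) * (A + B), by positivity, fun x hx => ?_⟩
  have h1 := norm_integral_fourierLaplace_le ae_le_im_horizontal
    (integrable_whitham_horizontal hs hs' n) hx
  have h2 := norm_integral_fourierLaplace_le ae_le_im_vertical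
    (integrable_whitham_vertical s n) hx
  refine (norm_add_le_of_le h1 h2).trans_eq ?_
  have : Real.exp (-s * (x - 1 / 4)) = Real.exp (s / 4) * Real.exp (-s * x) := by
    rw [← Real.exp_add]
    congr 1
    ring
  rw [← hA, ← hB, this]
  ring

theorem tendsto_integral_whithamSymbol (hs : 0 < s) (hs' : s < Real.pi / 2) {x : ℝ}
    (hx : 1 / 4 ≤ x) :
    Tendsto (fun R : ℝ => ∫ ξ in (0 : ℝ)..R, whithamSymbol ξ * Real.cos (x * ξ)) atTop
      (nhds (whithamContour s 0 x).re) := by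
  have hx0 : 0 < x := by linarith
  have hint := integrable_fourierLaplace_integrand aestronglyMeasurable_whithamSymbolC_vertical
    (Continuous.aestronglyMeasurable (by fun_prop)) ae_le_im_vertical
    (integrable_whitham_vertical s 0) hx
  have hB := intervalIntegral_tendsto_integral_Ioi s hint tendsto_id
  have hlim := ((hB.const_add (∫ t in Set.Ioc (0 : ℝ) 1, whithamSymbolC (t + s * Complex.I) *
    (Complex.I * (t + s * Complex.I)) ^ 0 *
      Complex.exp (Complex.I * x * (t + s * Complex.I)))).add
    ((tendsto_integral_top_edge hx0).sub
      ((tendsto_integral_right_edge hx0).const_mul Complex.I)))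
  rw [mul_zero, sub_zero, add_zero] at hlim
  refine ((Complex.continuous_re.tendsto _).comp hlim).congr' ?_
  filter_upwards [eventually_ge_atTop 1] with R hR
  have hre : ∫ ξ in (0 : ℝ)..R, whithamSymbol ξ * Real.cos (x * ξ) =
      (∫ ξ in (0 : ℝ)..R, whithamIntegrand x ξ).re := by
    have := intervalIntegral.intervalIntegral_re (μ := volume)
      (intervalIntegrable_whithamIntegrand x Complex.continuous_ofReal (a := 0) (b := R)
        fun t ht => by
          rw [Set.uIcc_of_le (by linarith)] at ht
          rcases ht.1.eq_or_lt with h | h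
          · exact Or.inr ⟨h.symm, by simp, by simp [Real.pi_pos]⟩
          · exact Or.inl h)
    simpa only [RCLike.re_eq_complex_re, whithamIntegrand_ofReal_re] using this
  have him : (∫ y in (0 : ℝ)..s, whithamIntegrand x (y * Complex.I)).im = 0 := by
    have := intervalIntegral.intervalIntegral_im (μ := volume)
      (intervalIntegrable_whithamIntegrand x (γ := fun y : ℝ => y * Complex.I) (by fun_prop)
        (a := 0) (b := s) fun t ht => by
          rw [Set.uIcc_of_le hs.le] at ht
          exact Or.inr ⟨by simp, by simpa using ht.1, by simpa using by linarith [ht.2]⟩)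
    rw [← RCLike.im_eq_complex_im, ← this]
    refine (intervalIntegral.integral_congr fun y hy => ?_).trans
      intervalIntegral.integral_zero
    rw [Set.uIcc_of_le hs.le] at hy
    exact whithamIntegrand_mul_I_im x hy.1 (by linarith [hy.2])
  rw [hre, integral_whithamIntegrand_eq x hs hs' hR, ← intervalIntegral.integral_of_le zero_le_one,
    ← intervalIntegral.integral_const_mul Complex.I (fun y : ℝ => whithamIntegrand x (1 + _))]
  simp only [Function.comp_apply, whithamIntegrand, pow_zero, mul_one, id, mul_assoc,
    Complex.add_re, Complex.I_mul_re] at him ⊢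
  rw [him]
  ring

theorem whithamKernel_eq (hs : 0 < s) (hs' : s < Real.pi / 2) {x : ℝ} (hx : 1 / 4 ≤ x) :
    whithamKernel x = 1 / Real.pi * (whithamContour s 0 x).re := by
  rw [whithamKernel, if_neg (by linarith)]
  exact ((tendsto_integral_whithamSymbol hs hs' hx).const_mul _).limUnder_eq

theorem iteratedDeriv_whithamKernel (hs : 0 < s) (hs' : s < Real.pi / 2) (n : ℕ) {x : ℝ}
    (hx : 1 / 4 < x) :
    iteratedDeriv n whithamKernel x = 1 / Real.pi * (whithamContour s n x).re := by
  induction n generalizing x with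
  | zero => simpa using whithamKernel_eq hs hs' hx.le
  | succ n ih =>
    have h : iteratedDeriv n whithamKernel =ᶠ[nhds x]
        fun x => 1 / Real.pi * (whithamContour s n x).re := by
      filter_upwards [Ioi_mem_nhds hx] with y hy using ih hy
    rw [iteratedDeriv_succ, h.deriv_eq]
    exact ((Complex.reCLM.hasFDerivAt.comp_hasDerivAt x
      (hasDerivAt_whithamContour hs hs' n hx)).const_mul _).deriv

end Contour

theorem whithamKernel_neg (x : ℝ) : whithamKernel (-x) = whithamKernel x := by
  simp [whithamKernel]

theorem abs_iteratedDeriv_whithamKernel_neg (n : ℕ) (x : ℝ) :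
    |iteratedDeriv n whithamKernel (-x)| = |iteratedDeriv n whithamKernel x| := by
  have h := iteratedDeriv_comp_neg n whithamKernel x
  simp only [whithamKernel_neg] at h
  rw [h, smul_eq_mul, abs_mul, abs_pow, abs_neg, abs_one, one_pow, one_mul]

theorem whitham_kernel_exponential_decay
    (s₀ : ℝ) (hs₀ : s₀ ∈ Set.Ioo 0 (Real.pi / 2)) (n : ℕ) :
    ∃ C : ℝ, 0 < C ∧ ∀ x : ℝ, 1 / 2 ≤ |x| →
      |iteratedDeriv n whithamKernel x| ≤ C * Real.exp (-s₀ * |x|) := by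
  obtain ⟨C, hC, h⟩ := norm_whithamContour_le hs₀.1 hs₀.2 n
  have key : ∀ x : ℝ, 1 / 2 ≤ x →
      |iteratedDeriv n whithamKernel x| ≤ (1 / Real.pi * C + 1) * Real.exp (-s₀ * x) := by
    intro x hx
    rw [iteratedDeriv_whithamKernel hs₀.1 hs₀.2 n (by linarith), abs_mul,
      abs_of_pos (one_div_pos.2 Real.pi_pos), add_mul, mul_assoc]
    have h1 := (Complex.abs_re_le_norm _).trans (h x (by linarith))
    have h2 := mul_le_mul_of_nonneg_left h1 (one_div_pos.2 Real.pi_pos).le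
    linarith [Real.exp_pos (-s₀ * x)]
  refine ⟨1 / Real.pi * C + 1, by positivity, fun x hx => ?_⟩
  rcases abs_cases x with ⟨hx', _⟩ | ⟨hx', _⟩
  · rw [hx'] at hx ⊢
    exact key x hx
  · rw [hx'] at hx ⊢
    rw [← abs_iteratedDeriv_whithamKernel_neg]
    exact key (-x) hx
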